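/- Let 0 < a < b be reals, and let p, q > 1 with 1/p + 1/q = 1. Then |2/(a+b) - (ln b - ln a)/(b-a)| ≤ ((b-a)²/8)(1/(p+1))^{1/p}(1/(2(q+2)))^{1/q} [ ( b^{-3q} + ((q+3)/(q+1)) a^{-3q} )^{1/q} + ( ((q+3)/(q+1)) b^{-3q} + a^{-3q} )^{1/q} ]. -/

import Mathlib

open MeasureTheory Set in
/-- Hölder's inequality for nonnegative continuous functions on `[a, b]`. -/
lemma intervalIntegral_mul_le_Lp_mul_Lq_of_nonneg {a b p q : ℝ} (hab : a ≤ b)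
    (hpq : p.HolderConjugate q) {f g : ℝ → ℝ}
    (hf : ContinuousOn f (Icc a b)) (hg : ContinuousOn g (Icc a b))
    (hf0 : ∀ t ∈ Icc a b, 0 ≤ f t) (hg0 : ∀ t ∈ Icc a b, 0 ≤ g t) :
    ∫ t in a..b, f t * g t ≤
      (∫ t in a..b, f t ^ p) ^ (1 / p) * (∫ t in a..b, g t ^ q) ^ (1 / q) := by
  have memLp {u : ℝ → ℝ} (hu : ContinuousOn u (Icc a b)) (r : ENNReal) :
      MemLp u r (volume.restrict (Ioc a b)) := by
    obtain ⟨C, hC⟩ := isCompact_Icc.exists_bound_of_continuousOn hu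
    exact .of_bound ((hu.mono Ioc_subset_Icc_self).aestronglyMeasurable measurableSet_Ioc) C
      (ae_restrict_of_forall_mem measurableSet_Ioc fun t ht => hC t (Ioc_subset_Icc_self ht))
  simp only [intervalIntegral.integral_of_le hab]
  exact integral_mul_le_Lp_mul_Lq_of_nonneg hpq
    (ae_restrict_of_forall_mem measurableSet_Ioc fun t ht => hf0 t (Ioc_subset_Icc_self ht))
    (ae_restrict_of_forall_mem measurableSet_Ioc fun t ht => hg0 t (Ioc_subset_Icc_self ht))
    (memLp hf _) (memLp hg _)

/-- Convexity of `x ↦ x ^ (-r)` on the positive reals. -/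
lemma weighted_add_rpow_neg_le {x y v w r : ℝ} (hx : 0 < x) (hy : 0 < y) (hv : 0 ≤ v)
    (hw : 0 ≤ w) (hvw : v + w = 1) (hr : 0 ≤ r) :
    (v * x + w * y) ^ (-r) ≤ v * x ^ (-r) + w * y ^ (-r) := by
  calc (v * x + w * y) ^ (-r) ≤ (x ^ v * y ^ w) ^ (-r) :=
        Real.rpow_le_rpow_of_nonpos (by positivity)
          (Real.geom_mean_le_arith_mean2_weighted hv hw hx.le hy.le hvw) (by linarith)
    _ = (x ^ (-r)) ^ v * (y ^ (-r)) ^ w := by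
        rw [Real.mul_rpow (by positivity) (by positivity), ← Real.rpow_mul hx.le,
          ← Real.rpow_mul hy.le, ← Real.rpow_mul hx.le, ← Real.rpow_mul hy.le,
          mul_comm v, mul_comm w]
    _ ≤ v * x ^ (-r) + w * y ^ (-r) :=
        Real.geom_mean_le_arith_mean2_weighted hv hw (by positivity) (by positivity) hvw

lemma add_half_sub_mul_pos {x y t : ℝ} (hx : 0 < x) (hy : 0 < y) (ht : t ∈ Set.Icc (0 : ℝ) 1) :
    0 < x + (y - x) / 2 * t := by
  nlinarith [ht.1, ht.2, mul_nonneg hy.le ht.1, mul_nonneg hx.le (sub_nonneg.2 ht.2)]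

lemma continuousOn_div_add_half_sub_mul_cube {u : ℝ → ℝ} (hu : Continuous u) {x y : ℝ}
    (hx : 0 < x) (hy : 0 < y) :
    ContinuousOn (fun t => u t / (x + (y - x) / 2 * t) ^ 3) (Set.Icc 0 1) :=
  hu.continuousOn.div (by fun_prop) fun _ ht => (pow_pos (add_half_sub_mul_pos hx hy ht) 3).ne'

lemma integral_sq_div_add_half_sub_mul_cube {x y : ℝ} (hx : 0 < x) (hy : 0 < y) (hxy : x ≠ y) :
    ∫ t in (0 : ℝ)..1, t * (t / (x + (y - x) / 2 * t) ^ 3) =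
      (2 / (y - x)) ^ 3 * (Real.log ((x + y) / 2) - Real.log x + 4 * x / (x + y)
        - 2 * x ^ 2 / (x + y) ^ 2 - 3 / 2) := by
  have hc : y - x ≠ 0 := sub_ne_zero.2 hxy.symm
  have hIcc : Set.uIcc (0 : ℝ) 1 = Set.Icc 0 1 := Set.uIcc_of_le zero_le_one
  have hderiv : ∀ t ∈ Set.uIcc (0 : ℝ) 1, HasDerivAt
      (fun t => (2 / (y - x)) ^ 3 * (Real.log (x + (y - x) / 2 * t)
        + 2 * x * (x + (y - x) / 2 * t)⁻¹ - x ^ 2 / 2 * ((x + (y - x) / 2 * t) ^ 2)⁻¹))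
      (t * (t / (x + (y - x) / 2 * t) ^ 3)) t := by
    intro t ht
    have hpos := add_half_sub_mul_pos hx hy (hIcc ▸ ht)
    have hlin : HasDerivAt (fun t => x + (y - x) / 2 * t) ((y - x) / 2) t := by
      simpa using ((hasDerivAt_id t).const_mul ((y - x) / 2)).const_add x
    have h := (((hlin.log hpos.ne').add ((hlin.inv hpos.ne').const_mul (2 * x))).sub
      (((hlin.pow 2).inv (pow_pos hpos 2).ne').const_mul (x ^ 2 / 2))).const_mul
        ((2 / (y - x)) ^ 3)
    refine h.congr_deriv ?_
    obtain ⟨z, hz⟩ : ∃ z, z = x + (y - x) / 2 * t := ⟨_, rfl⟩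
    have ht' : t = (z - x) * 2 / (y - x) := by rw [hz]; field_simp; ring
    simp only [Pi.pow_apply, ← hz]
    rw [← hz] at hpos
    rw [ht']
    field_simp
    ring
  have hcont : ContinuousOn (fun t => t * (t / (x + (y - x) / 2 * t) ^ 3)) (Set.uIcc 0 1) := by
    rw [hIcc]
    exact continuousOn_id.mul (continuousOn_div_add_half_sub_mul_cube continuous_id hx hy)
  rw [intervalIntegral.integral_eq_sub_of_hasDerivAt hderiv hcont.intervalIntegrable,
    show x + (y - x) / 2 * 1 = (x + y) / 2 by ring, show x + (y - x) / 2 * 0 = x by ring]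
  have : x + y ≠ 0 := by positivity
  field_simp
  ring

lemma integral_sq_div_add_half_sub_mul_cube_le {x y p q : ℝ} (hx : 0 < x) (hy : 0 < y)
    (hpq : p.HolderConjugate q) :
    ∫ t in (0 : ℝ)..1, t * (t / (x + (y - x) / 2 * t) ^ 3) ≤
      (1 / (p + 1)) ^ (1 / p) * ((1 / (2 * (q + 2))) ^ (1 / q) *
        (y ^ (-(3 * q)) + (q + 3) / (q + 1) * x ^ (-(3 * q))) ^ (1 / q)) := by
  have hp := hpq.pos
  have hq := hpq.symm.pos
  have hg := continuousOn_div_add_half_sub_mul_cube continuous_id hx hy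
  have hg0 : ∀ t ∈ Set.Icc (0 : ℝ) 1, 0 ≤ t / (x + (y - x) / 2 * t) ^ 3 := fun t ht =>
    div_nonneg ht.1 (pow_pos (add_half_sub_mul_pos hx hy ht) 3).le
  refine (intervalIntegral_mul_le_Lp_mul_Lq_of_nonneg zero_le_one hpq continuousOn_id hg
    (fun t ht => ht.1) hg0).trans ?_
  have hfp : ∫ t in (0 : ℝ)..1, (id t : ℝ) ^ p = 1 / (p + 1) := by
    simp only [id]
    rw [integral_rpow (.inl (by linarith)), Real.one_rpow, Real.zero_rpow (by positivity),
      sub_zero]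
  rw [hfp]
  rw [← Real.mul_rpow (by positivity) (by positivity)]
  refine mul_le_mul_of_nonneg_left (Real.rpow_le_rpow ?_ ?_ (by positivity)) (by positivity)
  · exact intervalIntegral.integral_nonneg zero_le_one fun t ht =>
      Real.rpow_nonneg (hg0 t ht) q
  set X := x ^ (-(3 * q))
  set Y := y ^ (-(3 * q))
  have hbound : ∀ t ∈ Set.Icc (0 : ℝ) 1, (t / (x + (y - x) / 2 * t) ^ 3) ^ q ≤
      X * t ^ q + (Y - X) / 2 * t ^ (q + 1) := by
    intro t ht
    have hpos := add_half_sub_mul_pos hx hy ht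
    have hconv := weighted_add_rpow_neg_le hx hy (v := 1 - t / 2) (w := t / 2) (r := 3 * q)
      (by linarith [ht.2]) (by linarith [ht.1]) (by ring) (by positivity)
    rw [show (1 - t / 2) * x + t / 2 * y = x + (y - x) / 2 * t by ring] at hconv
    calc (t / (x + (y - x) / 2 * t) ^ 3) ^ q
        = t ^ q * (x + (y - x) / 2 * t) ^ (-(3 * q)) := by
          rw [Real.div_rpow ht.1 (by positivity), Real.rpow_neg hpos.le,
            Real.rpow_mul hpos.le, div_eq_mul_inv]
          norm_cast
      _ ≤ t ^ q * ((1 - t / 2) * X + t / 2 * Y) :=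
          mul_le_mul_of_nonneg_left hconv (Real.rpow_nonneg ht.1 q)
      _ = X * t ^ q + (Y - X) / 2 * t ^ (q + 1) := by
          rw [Real.rpow_add_one' ht.1 (by positivity)]
          ring
  have hint₁ : IntervalIntegrable (fun t : ℝ => X * t ^ q) MeasureTheory.volume 0 1 :=
    (intervalIntegral.intervalIntegrable_rpow' (by linarith)).const_mul X
  have hint₂ : IntervalIntegrable (fun t : ℝ => (Y - X) / 2 * t ^ (q + 1))
      MeasureTheory.volume 0 1 :=
    (intervalIntegral.intervalIntegrable_rpow' (by linarith)).const_mul _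
  have hgq : IntervalIntegrable (fun t : ℝ => (t / (x + (y - x) / 2 * t) ^ 3) ^ q)
      MeasureTheory.volume 0 1 :=
    (hg.rpow_const fun _ _ => .inr hq.le).intervalIntegrable_of_Icc zero_le_one
  refine (intervalIntegral.integral_mono_on zero_le_one hgq (hint₁.add hint₂) hbound).trans_eq ?_
  rw [intervalIntegral.integral_add hint₁ hint₂, intervalIntegral.integral_const_mul,
    intervalIntegral.integral_const_mul, integral_rpow (.inl (by linarith)),
    integral_rpow (.inl (by linarith))]
  simp only [Real.one_rpow]
  rw [Real.zero_rpow (by positivity), Real.zero_rpow (by positivity)]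
  rw [show q + 1 + 1 = q + 2 by ring]
  field_simp
  ring

theorem stmt_17 (a b p q : ℝ) (ha : 0 < a) (hab : a < b)
    (hp : 1 < p) (hq : 1 < q) (hpq : 1/p + 1/q = 1) :
    |2/(a+b) - (Real.log b - Real.log a)/(b-a)|
    ≤ (b-a)^2/8 * (1/(p+1)) ^ (1/p) * (1/(2*(q+2))) ^ (1/q) *
      ((b ^ (-(3*q)) + ((q+3)/(q+1)) * a ^ (-(3*q))) ^ (1/q)
        + (((q+3)/(q+1)) * b ^ (-(3*q)) + a ^ (-(3*q))) ^ (1/q)) := by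
  have hb : 0 < b := ha.trans hab
  have hconj : p.HolderConjugate q :=
    Real.holderConjugate_iff.2 ⟨hp, by simpa only [one_div] using hpq⟩
  have hnonneg {x y : ℝ} (hx : 0 < x) (hy : 0 < y) :
      0 ≤ ∫ t in (0 : ℝ)..1, t * (t / (x + (y - x) / 2 * t) ^ 3) :=
    intervalIntegral.integral_nonneg zero_le_one fun t ht =>
      mul_nonneg ht.1 (div_nonneg ht.1 (pow_pos (add_half_sub_mul_pos hx hy ht) 3).le)
  have hab0 := hnonneg ha hb
  have hba0 := hnonneg hb ha
  have hab_le := integral_sq_div_add_half_sub_mul_cube_le ha hb hconj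
  have hba_le := integral_sq_div_add_half_sub_mul_cube_le hb ha hconj
  have hidentity : (Real.log b - Real.log a) / (b - a) - 2 / (a + b) = (b - a) ^ 2 / 8 *
      ((∫ t in (0 : ℝ)..1, t * (t / (a + (b - a) / 2 * t) ^ 3)) +
        ∫ t in (0 : ℝ)..1, t * (t / (b + (a - b) / 2 * t) ^ 3)) := by
    rw [integral_sq_div_add_half_sub_mul_cube ha hb hab.ne,
      integral_sq_div_add_half_sub_mul_cube hb ha hab.ne', add_comm b a,
      show a - b = -(b - a) by ring]
    have : b - a ≠ 0 := sub_ne_zero.2 hab.ne'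
    have : a + b ≠ 0 := by positivity
    field_simp
    ring
  rw [abs_sub_comm, hidentity, abs_of_nonneg (by positivity),
    add_comm ((q + 3) / (q + 1) * b ^ (-(3 * q)))]
  refine (mul_le_mul_of_nonneg_left (add_le_add hab_le hba_le) (by positivity)).trans_eq ?_
  ring
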